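/- Let m ≤ n, f : {0,1}^n → {0,1}, G = ([n], E) a directed graph, C = {(i,j) ∈ E : i ≤ m < j}, D = {(i,j) ∈ E : j ≤ m < i}, and let S ⊆ {0,1}^m × {0,1}^{n−m} be a fooling set for f (with value b) such that for every (x,y), (x′,y′) ∈ S: if (i,j) ∈ C then x_i = x′_i, and if (i,j) ∈ D then y_i = y′_i. Let A_n = (Σ, δ) be a label-stabilizing stateless protocol on G that computes f. Then for every two distinct (x,y), (x′,y′) ∈ S and every two initial labelings ℓ¹, ℓ² ∈ Σ^E, the eventual (stable) labelings ℓ̂¹ and ℓ̂² reached by the synchronous runs of A_n on input (x,y) from ℓ¹ and on input (x′,y′) from ℓ², respectively, differ on at least one edge of C ∪ D. Consequently there is an injection from S into the labelings of C ∪ D, so |S| ≤ |Σ|^{|C ∪ D|}. -/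

import Mathlib

/-- A stateless protocol on the directed graph with node set `Fin n` and edge set
`E`, with label space `Λ`.  `react i` maps the current labeling (of which only
the values on `i`'s incoming edges may be used, per `react_local`) together with
`i`'s input bit to a new labeling (of which only the values on `i`'s outgoing
edges are ever read) together with an output bit. -/
structure StatelessProtocol (n : ℕ) (E : Finset (Fin n × Fin n)) (Λ : Type) where
  react : Fin n → ({e // e ∈ E} → Λ) → Bool → ({e // e ∈ E} → Λ) × Bool
  react_local : ∀ (i : Fin n) (ℓ ℓ' : {e // e ∈ E} → Λ) (x : Bool),
      (∀ e : {e // e ∈ E}, e.1.2 = i → ℓ e = ℓ' e) → react i ℓ x = react i ℓ' x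

namespace StatelessProtocol

variable {n : ℕ} {E : Finset (Fin n × Fin n)} {Λ : Type}

/-- `run P x σ ℓ0 t` is the labeling after `t` time steps of the run of `P` on
input `x` from initial labeling `ℓ0`, where `σ t` is the set of nodes activated
at time step `t + 1`. -/
def run (P : StatelessProtocol n E Λ) (x : Fin n → Bool) (σ : ℕ → Finset (Fin n))
    (ℓ0 : {e // e ∈ E} → Λ) : ℕ → {e // e ∈ E} → Λ
  | 0 => ℓ0
  | t + 1 => fun e =>
      if e.1.1 ∈ σ t then (P.react e.1.1 (run P x σ ℓ0 t) (x e.1.1)).1 e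
      else run P x σ ℓ0 t e

/-- A schedule is `r`-fair if every node is activated at least once in every
window of `r` consecutive time steps. -/
def Fair (σ : ℕ → Finset (Fin n)) (r : ℕ) : Prop :=
  ∀ (i : Fin n) (t : ℕ), ∃ s, t ≤ s ∧ s < t + r ∧ i ∈ σ s

/-- A labeling is stable for input `x` if every reaction function is at a fixed
point: each node's prescribed outgoing labels coincide with the current ones. -/
def Stable (P : StatelessProtocol n E Λ) (x : Fin n → Bool)
    (ℓ : {e // e ∈ E} → Λ) : Prop :=
  ∀ e : {e // e ∈ E}, (P.react e.1.1 ℓ (x e.1.1)).1 e = ℓ e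

/-- The labeling after `t` steps of the synchronous run (all nodes activated at
every step). -/
def syncRun (P : StatelessProtocol n E Λ) (x : Fin n → Bool)
    (ℓ0 : {e // e ∈ E} → Λ) : ℕ → {e // e ∈ E} → Λ :=
  P.run x (fun _ => Finset.univ) ℓ0

/-- The outputs at time step `t` of the synchronous run (the value at time `0`
is a dummy value). -/
def syncOut (P : StatelessProtocol n E Λ) (x : Fin n → Bool)
    (ℓ0 : {e // e ∈ E} → Λ) : ℕ → Fin n → Bool
  | 0 => fun _ => false
  | t + 1 => fun i => (P.react i (P.syncRun x ℓ0 t) (x i)).2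

/-- Output stabilization under the synchronous schedule. -/
def OutputStabilizing (P : StatelessProtocol n E Λ) : Prop :=
  ∀ x ℓ0, ∃ T, ∀ t, T ≤ t → P.syncOut x ℓ0 t = P.syncOut x ℓ0 T

/-- Label stabilization under the synchronous schedule. -/
def LabelStabilizing (P : StatelessProtocol n E Λ) : Prop :=
  ∀ x ℓ0, ∃ T, ∀ t, T ≤ t → P.syncRun x ℓ0 t = P.syncRun x ℓ0 T

/-- `P` computes `f` if on every input and from every initial labeling, every
node's output sequence converges to `f x` under the synchronous schedule. -/
def Computes (P : StatelessProtocol n E Λ) (f : (Fin n → Bool) → Bool) : Prop :=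
  ∀ x ℓ0, ∃ T, ∀ t, T ≤ t → ∀ i, P.syncOut x ℓ0 t i = f x

end StatelessProtocol

/-- Glue an assignment on the first `m` coordinates and one on the remaining
`n - m` coordinates into an assignment on all `n` coordinates. -/
def glue {n m : ℕ} (x : Fin m → Bool) (y : Fin (n - m) → Bool) : Fin n → Bool :=
  fun i => if h : (i : ℕ) < m then x ⟨i, h⟩
    else y ⟨(i : ℕ) - m, by have := i.isLt; omega⟩

namespace StatelessProtocol

theorem syncRun_succ_apply {n : ℕ} {E : Finset (Fin n × Fin n)} {Λ : Type}
    (P : StatelessProtocol n E Λ) (x : Fin n → Bool) (ℓ0 : {e // e ∈ E} → Λ) (t : ℕ)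
    (e : {e // e ∈ E}) :
    P.syncRun x ℓ0 (t + 1) e = (P.react e.1.1 (P.syncRun x ℓ0 t) (x e.1.1)).1 e := by
  simp [syncRun, run]

theorem stable_of_eventual {n : ℕ} {E : Finset (Fin n × Fin n)} {Λ : Type}
    (P : StatelessProtocol n E Λ) (x : Fin n → Bool) (ℓ0 : {e // e ∈ E} → Λ) (T : ℕ)
    (h : ∀ t, T ≤ t → P.syncRun x ℓ0 t = P.syncRun x ℓ0 T) :
    P.Stable x (P.syncRun x ℓ0 T) := by
  intro e
  rw [← syncRun_succ_apply, h (T + 1) (Nat.le_succ T)]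

theorem syncRun_of_stable {n : ℕ} {E : Finset (Fin n × Fin n)} {Λ : Type}
    (P : StatelessProtocol n E Λ) (x : Fin n → Bool) (ℓ : {e // e ∈ E} → Λ)
    (h : P.Stable x ℓ) (t : ℕ) : P.syncRun x ℓ t = ℓ := by
  induction t with
  | zero => rfl
  | succ t ih =>
    funext e
    rw [syncRun_succ_apply, ih]
    exact h e

theorem out_of_stable {n : ℕ} {E : Finset (Fin n × Fin n)} {Λ : Type}
    (P : StatelessProtocol n E Λ) (f : (Fin n → Bool) → Bool) (hcomp : P.Computes f)
    (x : Fin n → Bool) (ℓ : {e // e ∈ E} → Λ)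
    (h : P.Stable x ℓ) (i : Fin n) : (P.react i ℓ (x i)).2 = f x := by
  obtain ⟨T, hT⟩ := hcomp x ℓ
  have h1 := hT (T + 1) (Nat.le_succ T) i
  simpa [syncOut, syncRun_of_stable P x ℓ h T] using h1

/-- Cut and paste: stable labelings agreeing on the cut edges combine. -/
theorem paste {n m : ℕ} {E : Finset (Fin n × Fin n)} {Λ : Type}
    (P : StatelessProtocol n E Λ) (f : (Fin n → Bool) → Bool) (hcomp : P.Computes f) (b : Bool)
    (hn : 0 < n)
    (p q : (Fin m → Bool) × (Fin (n - m) → Bool)) (ℓ1 ℓ2 : {e // e ∈ E} → Λ)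
    (hp : f (glue p.1 p.2) = b) (hq : f (glue q.1 q.2) = b)
    (h1 : P.Stable (glue p.1 p.2) ℓ1) (h2 : P.Stable (glue q.1 q.2) ℓ2)
    (hC : ∀ e : {e // e ∈ E}, e.1.1.1 < m → m ≤ e.1.2.1 → ℓ1 e = ℓ2 e)
    (hD : ∀ e : {e // e ∈ E}, e.1.2.1 < m → m ≤ e.1.1.1 → ℓ1 e = ℓ2 e) :
    f (glue p.1 q.2) = b := by
  let ℓ : {e // e ∈ E} → Λ := fun e => if e.1.1.1 < m then ℓ1 e else ℓ2 e
  have hlo : ∀ i : Fin n, i.1 < m →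
      P.react i ℓ (glue p.1 q.2 i) = P.react i ℓ1 (glue p.1 p.2 i) := by
    intro i hi
    have hx : glue p.1 q.2 i = glue p.1 p.2 i := by simp [glue, hi]
    rw [hx]
    apply P.react_local
    intro e he
    by_cases hs : e.1.1.1 < m
    · simp [ℓ, hs]
    · simp only [ℓ, hs, if_false]
      exact (hD e (by rw [he]; exact hi) (not_lt.mp hs)).symm
  have hhi : ∀ i : Fin n, ¬ i.1 < m →
      P.react i ℓ (glue p.1 q.2 i) = P.react i ℓ2 (glue q.1 q.2 i) := by
    intro i hi
    have hx : glue p.1 q.2 i = glue q.1 q.2 i := by simp [glue, hi]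
    rw [hx]
    apply P.react_local
    intro e he
    by_cases hs : e.1.1.1 < m
    · simp only [ℓ, hs, if_true]
      exact hC e hs (by rw [he]; exact not_lt.mp hi)
    · simp [ℓ, hs]
  have hst : P.Stable (glue p.1 q.2) ℓ := by
    intro e
    by_cases hs : e.1.1.1 < m
    · rw [hlo _ hs, h1 e]
      simp [ℓ, hs]
    · rw [hhi _ hs, h2 e]
      simp [ℓ, hs]
  have ho := out_of_stable P f hcomp _ ℓ hst ⟨0, hn⟩
  rw [← ho]
  by_cases hs : (⟨0, hn⟩ : Fin n).1 < m
  · rw [hlo _ hs, out_of_stable P f hcomp _ ℓ1 h1, hp]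
  · rw [hhi _ hs, out_of_stable P f hcomp _ ℓ2 h2, hq]

end StatelessProtocol

open StatelessProtocol in
/-- Under the fooling-set hypotheses, for every two distinct
members of the fooling set and every two initial labelings, the eventual stable
labelings of the two synchronous runs differ on some edge of `C ∪ D`;
consequently `|S| ≤ |Σ|^{|C ∪ D|}`. -/
theorem fooling_set_distinct_stable_labelings
    {n m : ℕ} (hm : m ≤ n) (E : Finset (Fin n × Fin n))
    (f : (Fin n → Bool) → Bool)
    (S : Finset ((Fin m → Bool) × (Fin (n - m) → Bool))) (b : Bool)
    (hSb : ∀ p ∈ S, f (glue p.1 p.2) = b)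
    (hfool : ∀ p ∈ S, ∀ q ∈ S, p ≠ q →
      f (glue p.1 q.2) ≠ b ∨ f (glue q.1 p.2) ≠ b)
    (hCagree : ∀ p ∈ S, ∀ q ∈ S, ∀ e ∈ E, ∀ h : (e.1 : Fin n).1 < m,
      m ≤ (e.2 : Fin n).1 → p.1 ⟨(e.1 : Fin n).1, h⟩ = q.1 ⟨(e.1 : Fin n).1, h⟩)
    (hDagree : ∀ p ∈ S, ∀ q ∈ S, ∀ e ∈ E, (e.2 : Fin n).1 < m →
      ∀ h : m ≤ (e.1 : Fin n).1,
      p.2 ⟨(e.1 : Fin n).1 - m, by have := (e.1 : Fin n).isLt; omega⟩ =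
      q.2 ⟨(e.1 : Fin n).1 - m, by have := (e.1 : Fin n).isLt; omega⟩)
    {Λ : Type} [Fintype Λ] [Nonempty Λ]
    (P : StatelessProtocol n E Λ)
    (hls : P.LabelStabilizing) (hcomp : P.Computes f) :
    (∀ p ∈ S, ∀ q ∈ S, p ≠ q →
      ∀ (ℓ1 ℓ2 : {e // e ∈ E} → Λ) (T1 T2 : ℕ),
        (∀ t, T1 ≤ t → P.syncRun (glue p.1 p.2) ℓ1 t = P.syncRun (glue p.1 p.2) ℓ1 T1) →
        (∀ t, T2 ≤ t → P.syncRun (glue q.1 q.2) ℓ2 t = P.syncRun (glue q.1 q.2) ℓ2 T2) →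
        ∃ e : {e // e ∈ E},
          (e.1 ∈ E.filter (fun e => (e.1 : Fin n).1 < m ∧ m ≤ (e.2 : Fin n).1) ∪
                 E.filter (fun e => (e.2 : Fin n).1 < m ∧ m ≤ (e.1 : Fin n).1)) ∧
          P.syncRun (glue p.1 p.2) ℓ1 T1 e ≠ P.syncRun (glue q.1 q.2) ℓ2 T2 e) ∧
    S.card ≤ Fintype.card Λ ^
      (E.filter (fun e => (e.1 : Fin n).1 < m ∧ m ≤ (e.2 : Fin n).1) ∪
       E.filter (fun e => (e.2 : Fin n).1 < m ∧ m ≤ (e.1 : Fin n).1)).card := by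
  have main : ∀ p ∈ S, ∀ q ∈ S, p ≠ q →
      ∀ (ℓ1 ℓ2 : {e // e ∈ E} → Λ) (T1 T2 : ℕ),
        (∀ t, T1 ≤ t → P.syncRun (glue p.1 p.2) ℓ1 t = P.syncRun (glue p.1 p.2) ℓ1 T1) →
        (∀ t, T2 ≤ t → P.syncRun (glue q.1 q.2) ℓ2 t = P.syncRun (glue q.1 q.2) ℓ2 T2) →
        ∃ e : {e // e ∈ E},
          (e.1 ∈ E.filter (fun e => (e.1 : Fin n).1 < m ∧ m ≤ (e.2 : Fin n).1) ∪
                 E.filter (fun e => (e.2 : Fin n).1 < m ∧ m ≤ (e.1 : Fin n).1)) ∧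
          P.syncRun (glue p.1 p.2) ℓ1 T1 e ≠ P.syncRun (glue q.1 q.2) ℓ2 T2 e := by
    intro p hp q hq hpq ℓ1 ℓ2 T1 T2 hT1 hT2
    have hn : 0 < n := by
      rcases Nat.eq_zero_or_pos n with h0 | h0
      · exfalso
        apply hpq
        apply Prod.ext
        · funext i
          have := i.isLt
          omega
        · funext i
          have := i.isLt
          omega
      · exact h0
    by_contra hcon
    have hag : ∀ e : {e // e ∈ E},
        (e.1.1.1 < m ∧ m ≤ e.1.2.1) ∨ (e.1.2.1 < m ∧ m ≤ e.1.1.1) →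
        P.syncRun (glue p.1 p.2) ℓ1 T1 e = P.syncRun (glue q.1 q.2) ℓ2 T2 e := by
      intro e he
      by_contra hne
      refine hcon ⟨e, ?_, hne⟩
      rw [Finset.mem_union, Finset.mem_filter, Finset.mem_filter]
      exact he.imp (fun h => ⟨e.2, h⟩) (fun h => ⟨e.2, h⟩)
    have s1 := stable_of_eventual P _ ℓ1 T1 hT1
    have s2 := stable_of_eventual P _ ℓ2 T2 hT2
    rcases hfool p hp q hq hpq with h | h
    · exact h (paste P f hcomp b hn p q _ _ (hSb p hp) (hSb q hq) s1 s2
        (fun e h1 h2 => hag e (Or.inl ⟨h1, h2⟩)) (fun e h1 h2 => hag e (Or.inr ⟨h1, h2⟩)))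
    · exact h (paste P f hcomp b hn q p _ _ (hSb q hq) (hSb p hp) s2 s1
        (fun e h1 h2 => (hag e (Or.inl ⟨h1, h2⟩)).symm)
        (fun e h1 h2 => (hag e (Or.inr ⟨h1, h2⟩)).symm))
  refine ⟨main, ?_⟩
  classical
  obtain ⟨a⟩ := ‹Nonempty Λ›
  choose T hT using fun p : (Fin m → Bool) × (Fin (n - m) → Bool) =>
    hls (glue p.1 p.2) (fun _ => a)
  set K := E.filter (fun e => (e.1 : Fin n).1 < m ∧ m ≤ (e.2 : Fin n).1) ∪
       E.filter (fun e => (e.2 : Fin n).1 < m ∧ m ≤ (e.1 : Fin n).1) with hK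
  have hKE : ∀ e ∈ K, e ∈ E := by
    intro e he
    rw [hK, Finset.mem_union, Finset.mem_filter, Finset.mem_filter] at he
    exact he.elim (fun h => h.1) (fun h => h.1)
  let g : {p // p ∈ S} → ({e // e ∈ K} → Λ) := fun p e =>
    P.syncRun (glue p.1.1 p.1.2) (fun _ => a) (T p.1) ⟨e.1, hKE e.1 e.2⟩
  have hg : Function.Injective g := by
    intro p q hpq
    by_contra hne
    obtain ⟨e, he, hd⟩ := main p.1 p.2 q.1 q.2 (fun h => hne (Subtype.ext h))
      (fun _ => a) (fun _ => a) (T p.1) (T q.1) (hT p.1) (hT q.1)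
    exact hd (congrFun hpq ⟨e.1, he⟩)
  have hcard := Fintype.card_le_of_injective g hg
  simpa using hcard
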